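/- Let H be a quasi-Hopf algebra over a field k with bijective antipode S, and let X be a left H-module. Let X₀ denote the vector space X with H acting through ε (h·x = ε(h)x), and give H⊗X₀ and H⊗X the tensor product left H-module structures (H acting on the first factor by left multiplication and diagonally via Δ). Then the map θ_X : H⊗X₀ → H⊗X, θ_X(h⊗x) = h_(1) p^R_1 ⊗ h_(2) p^R_2 x, is an H-linear bijection, with inverse given by h⊗x ↦ q^R_1 h_(1) ⊗ S(q^R_2 h_(2)) x. -/

import Mathlib

open scoped TensorProduct

noncomputable section

/-- A quasi-Hopf algebra over a field `k`, presented together with explicit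
(Sweedler-style) finite representations of the comultiplication and of the
associator `φ` and its inverse `φ⁻¹`.  The fields `n, d1, d2` give, for every
`h : H`, a finite family with `Δ h = ∑ i < n h, d1 h i ⊗ d2 h i`; similarly
`P1, P2, P3` (resp. `Q1, Q2, Q3`) are the components of `φ` (resp. `φ⁻¹`). -/
structure QuasiHopf (k H : Type) [Field k] [Ring H] [Algebra k H] where
  comul : H →ₐ[k] H ⊗[k] H
  counit : H →ₐ[k] k
  n : H → ℕ
  d1 : H → ℕ → H
  d2 : H → ℕ → H
  comul_eq : ∀ h, comul h = ∑ i ∈ Finset.range (n h), d1 h i ⊗ₜ[k] d2 h i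
  np : ℕ
  P1 : ℕ → H
  P2 : ℕ → H
  P3 : ℕ → H
  nq : ℕ
  Q1 : ℕ → H
  Q2 : ℕ → H
  Q3 : ℕ → H
  S : H →ₗ[k] H
  Sinv : H →ₗ[k] H
  alpha : H
  beta : H
  S_one : S 1 = 1
  S_mul : ∀ x y : H, S (x * y) = S y * S x
  Sinv_S : ∀ x : H, Sinv (S x) = x
  S_Sinv : ∀ x : H, S (Sinv x) = x
  phi_phiInv :
    (∑ a ∈ Finset.range np, P1 a ⊗ₜ[k] (P2 a ⊗ₜ[k] P3 a)) *
      (∑ b ∈ Finset.range nq, Q1 b ⊗ₜ[k] (Q2 b ⊗ₜ[k] Q3 b)) = 1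
  phiInv_phi :
    (∑ b ∈ Finset.range nq, Q1 b ⊗ₜ[k] (Q2 b ⊗ₜ[k] Q3 b)) *
      (∑ a ∈ Finset.range np, P1 a ⊗ₜ[k] (P2 a ⊗ₜ[k] P3 a)) = 1
  qcoassoc : ∀ h : H,
    ∑ i ∈ Finset.range (n h), d1 h i ⊗ₜ[k] comul (d2 h i) =
      (∑ a ∈ Finset.range np, P1 a ⊗ₜ[k] (P2 a ⊗ₜ[k] P3 a)) *
        (∑ i ∈ Finset.range (n h), ∑ j ∈ Finset.range (n (d1 h i)),
          d1 (d1 h i) j ⊗ₜ[k] (d2 (d1 h i) j ⊗ₜ[k] d2 h i)) *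
        (∑ b ∈ Finset.range nq, Q1 b ⊗ₜ[k] (Q2 b ⊗ₜ[k] Q3 b))
  counit_left : ∀ h : H, ∑ i ∈ Finset.range (n h), counit (d1 h i) • d2 h i = h
  counit_right : ∀ h : H, ∑ i ∈ Finset.range (n h), counit (d2 h i) • d1 h i = h
  pentagon :
    (∑ a ∈ Finset.range np, P1 a ⊗ₜ[k] (P2 a ⊗ₜ[k] comul (P3 a))) *
      (∑ a ∈ Finset.range np, ∑ i ∈ Finset.range (n (P1 a)),
        d1 (P1 a) i ⊗ₜ[k] (d2 (P1 a) i ⊗ₜ[k] (P2 a ⊗ₜ[k] P3 a))) =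
    ((1 : H) ⊗ₜ[k] (∑ a ∈ Finset.range np, P1 a ⊗ₜ[k] (P2 a ⊗ₜ[k] P3 a))) *
      (∑ a ∈ Finset.range np, ∑ i ∈ Finset.range (n (P2 a)),
        P1 a ⊗ₜ[k] (d1 (P2 a) i ⊗ₜ[k] (d2 (P2 a) i ⊗ₜ[k] P3 a))) *
      (∑ a ∈ Finset.range np, P1 a ⊗ₜ[k] (P2 a ⊗ₜ[k] (P3 a ⊗ₜ[k] (1 : H))))
  counit_mid_phi :
    ∑ a ∈ Finset.range np, counit (P2 a) • (P1 a ⊗ₜ[k] P3 a) = (1 : H) ⊗ₜ[k] (1 : H)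
  antipode_alpha : ∀ h : H,
    ∑ i ∈ Finset.range (n h), S (d1 h i) * alpha * d2 h i = counit h • alpha
  antipode_beta : ∀ h : H,
    ∑ i ∈ Finset.range (n h), d1 h i * beta * S (d2 h i) = counit h • beta
  nondeg_1 : ∑ a ∈ Finset.range np, P1 a * beta * S (P2 a) * alpha * P3 a = 1
  nondeg_2 : ∑ b ∈ Finset.range nq, S (Q1 b) * alpha * Q2 b * beta * S (Q3 b) = 1
  counit_alpha : counit alpha = 1
  counit_beta : counit beta = 1

namespace QuasiHopf

variable {k H : Type} [Field k] [Ring H] [Algebra k H] (q : QuasiHopf k H)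

/-- The associator `φ` as an element of `H ⊗ H ⊗ H`. -/
def Phi : H ⊗[k] (H ⊗[k] H) :=
  ∑ a ∈ Finset.range q.np, q.P1 a ⊗ₜ[k] (q.P2 a ⊗ₜ[k] q.P3 a)

/-- `φ⁻¹` as an element of `H ⊗ H ⊗ H`. -/
def PhiInv : H ⊗[k] (H ⊗[k] H) :=
  ∑ b ∈ Finset.range q.nq, q.Q1 b ⊗ₜ[k] (q.Q2 b ⊗ₜ[k] q.Q3 b)

/-- first components of `p^R = φ̄1 ⊗ φ̄2 β S(φ̄3)` -/
def pR1 (b : ℕ) : H := q.Q1 b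

def pR2 (b : ℕ) : H := q.Q2 b * q.beta * q.S (q.Q3 b)

def pRE : H ⊗[k] H := ∑ b ∈ Finset.range q.nq, q.pR1 b ⊗ₜ[k] q.pR2 b

/-- components of `q^R = φ1 ⊗ S̄(α φ3) φ2` -/
def qR1 (a : ℕ) : H := q.P1 a

def qR2 (a : ℕ) : H := q.Sinv (q.alpha * q.P3 a) * q.P2 a

def qRE : H ⊗[k] H := ∑ a ∈ Finset.range q.np, q.qR1 a ⊗ₜ[k] q.qR2 a

/-- components of `p^L = φ2 S̄(φ1 β) ⊗ φ3` -/
def pL1 (a : ℕ) : H := q.P2 a * q.Sinv (q.P1 a * q.beta)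

def pL2 (a : ℕ) : H := q.P3 a

def pLE : H ⊗[k] H := ∑ a ∈ Finset.range q.np, q.pL1 a ⊗ₜ[k] q.pL2 a

/-- components of `q^L = S(φ̄1) α φ̄2 ⊗ φ̄3` -/
def qL1 (b : ℕ) : H := q.S (q.Q1 b) * q.alpha * q.Q2 b

def qL2 (b : ℕ) : H := q.Q3 b

def qLE : H ⊗[k] H := ∑ b ∈ Finset.range q.nq, q.qL1 b ⊗ₜ[k] q.qL2 b

/-- `𝕒 = S(φ̄1 φ2) α φ̄2 φ3₍₁₎ ⊗ S(φ1) α φ̄3 φ3₍₂₎` -/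
def aEl : H ⊗[k] H :=
  ∑ a ∈ Finset.range q.np, ∑ b ∈ Finset.range q.nq, ∑ m ∈ Finset.range (q.n (q.P3 a)),
    (q.S (q.Q1 b * q.P2 a) * q.alpha * q.Q2 b * q.d1 (q.P3 a) m) ⊗ₜ[k]
      (q.S (q.P1 a) * q.alpha * q.Q3 b * q.d2 (q.P3 a) m)

/-- `𝕓 = φ1₍₁₎ φ̄1 β S(φ3) ⊗ φ1₍₂₎ φ̄2 β S(φ2 φ̄3)` -/
def bEl : H ⊗[k] H :=
  ∑ a ∈ Finset.range q.np, ∑ b ∈ Finset.range q.nq, ∑ m ∈ Finset.range (q.n (q.P1 a)),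
    (q.d1 (q.P1 a) m * q.Q1 b * q.beta * q.S (q.P3 a)) ⊗ₜ[k]
      (q.d2 (q.P1 a) m * q.Q2 b * q.beta * q.S (q.P2 a * q.Q3 b))

/-- `(S ⊗ S)(Δ^cop x) = S(x₍₂₎) ⊗ S(x₍₁₎)` -/
def scop (x : H) : H ⊗[k] H :=
  ∑ m ∈ Finset.range (q.n x), q.S (q.d2 x m) ⊗ₜ[k] q.S (q.d1 x m)

/-- The Drinfeld twist `f = (S⊗S)(Δ^cop(p^R_1)) · 𝕒 · Δ(p^R_2)`. -/
def twist : H ⊗[k] H :=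
  ∑ b ∈ Finset.range q.nq, q.scop (q.pR1 b) * q.aEl * q.comul (q.pR2 b)

/-- `f⁻¹ = Δ(q^L_1) · 𝕓 · (S⊗S)(Δ^cop(q^L_2))`. -/
def twistInv : H ⊗[k] H :=
  ∑ b ∈ Finset.range q.nq, q.comul (q.qL1 b) * q.bEl * q.scop (q.qL2 b)

/-- `x ⊗ y ↦ S y ⊗ S x` -/
def sswap : H ⊗[k] H →ₗ[k] H ⊗[k] H :=
  (TensorProduct.map q.S q.S).comp (TensorProduct.comm k H H).toLinearMap

/-- `x ⊗ y ↦ S̄ y ⊗ S̄ x` -/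
def sswapInv : H ⊗[k] H →ₗ[k] H ⊗[k] H :=
  (TensorProduct.map q.Sinv q.Sinv).comp (TensorProduct.comm k H H).toLinearMap

/-- `U^L = f̄1 S(q^R_2) ⊗ f̄2 S(q^R_1)` -/
def UL : H ⊗[k] H := q.twistInv * q.sswap q.qRE

/-- `V^L = S̄(f2 p^R_2) ⊗ S̄(f1 p^R_1)` -/
def VL : H ⊗[k] H := q.sswapInv (q.twist * q.pRE)

/-- `U^R = S̄(q^L_2 f̄2) ⊗ S̄(q^L_1 f̄1)` -/
def UR : H ⊗[k] H := q.sswapInv (q.qLE * q.twistInv)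

/-- `V^R = S(p^L_2) f1 ⊗ S(p^L_1) f2` -/
def VR : H ⊗[k] H := q.sswap q.pLE * q.twist

/-- `h ↦ h ↼ μ = μ(h₍₁₎) h₍₂₎` -/
def lhook (mu : H →ₐ[k] k) : H →ₗ[k] H :=
  (TensorProduct.lid k H).toLinearMap.comp
    ((TensorProduct.map mu.toLinearMap LinearMap.id).comp q.comul.toLinearMap)

/-- `h ↦ μ ⇀ h = μ(h₍₂₎) h₍₁₎` -/
def rhook (mu : H →ₐ[k] k) : H →ₗ[k] H :=
  (TensorProduct.rid k H).toLinearMap.comp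
    ((TensorProduct.map LinearMap.id mu.toLinearMap).comp q.comul.toLinearMap)

/-- `W^L = μ(φ̄1) f̄1 S(q^R_2 φ̄3) ⊗ f̄2 S((q^R_1 ↼ μ) φ̄2)` -/
def WL (mu : H →ₐ[k] k) : H ⊗[k] H :=
  q.twistInv * q.sswap ((TensorProduct.map (q.lhook mu) LinearMap.id q.qRE) *
    (∑ b ∈ Finset.range q.nq, mu (q.Q1 b) • (q.Q2 b ⊗ₜ[k] q.Q3 b)))

/-- `W^R = μ(φ3) S̄((μ ⇀ q^L_2) φ2 f̄2) ⊗ S̄(q^L_1 φ1 f̄1)` -/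
def WR (mu : H →ₐ[k] k) : H ⊗[k] H :=
  q.sswapInv ((TensorProduct.map LinearMap.id (q.rhook mu) q.qLE) *
    (∑ a ∈ Finset.range q.np, mu (q.P3 a) • (q.P1 a ⊗ₜ[k] q.P2 a)) * q.twistInv)

section Modules

variable {V W X : Type} [AddCommGroup V] [Module k V] [AddCommGroup W] [Module k W]
  [AddCommGroup X] [Module k X]

/-- The tensor-product action `h · (v ⊗ w) = h₍₁₎ v ⊗ h₍₂₎ w`. -/
def tensAct (ρV : H → Module.End k V) (ρW : H → Module.End k W) (h : H) :
    Module.End k (V ⊗[k] W) :=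
  ∑ i ∈ Finset.range (q.n h), TensorProduct.map (ρV (q.d1 h i)) (ρW (q.d2 h i))

/-- The action on the left dual: `(h · ξ)(x) = ξ(S(h) x)`. -/
def dualAct (ρX : H → Module.End k X) (h : H) : Module.End k (Module.Dual k X) :=
  LinearMap.dualMap (ρX (q.S h))

end Modules

end QuasiHopf

/-- `f` intertwines the two given `H`-actions. -/
def IsHLin {k H V W : Type} [Field k] [Ring H] [Algebra k H]
    [AddCommGroup V] [Module k V] [AddCommGroup W] [Module k W]
    (ρV : H → Module.End k V) (ρW : H → Module.End k W) (f : V →ₗ[k] W) : Prop :=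
  ∀ (h : H) (v : V), f (ρV h v) = ρW h (f v)

/-- `x ⊗ y ↦ λ(y) • x` -/
def hitR {k H : Type} [Field k] [Ring H] [Algebra k H] (lam : H →ₗ[k] k) :
    H ⊗[k] H →ₗ[k] H :=
  (TensorProduct.rid k H).toLinearMap.comp (TensorProduct.map LinearMap.id lam)

/-- `x ⊗ y ↦ λ(x) • y` -/
def hitL {k H : Type} [Field k] [Ring H] [Algebra k H] (lam : H →ₗ[k] k) :
    H ⊗[k] H →ₗ[k] H :=
  (TensorProduct.lid k H).toLinearMap.comp (TensorProduct.map lam LinearMap.id)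

namespace QuasiHopf

variable {k H : Type} [Field k] [Ring H] [Algebra k H] (q : QuasiHopf k H)
variable {X : Type} [AddCommGroup X] [Module k X]

/-- The action `H ⊗ X →ₗ X` as a linear map on the tensor product. -/
def muAct (ρX : H →ₐ[k] Module.End k X) : H ⊗[k] X →ₗ[k] X :=
  TensorProduct.lift ρX.toLinearMap

/-- `h ⊗ y ↦ h₍₁₎ ⊗ h₍₂₎ · y`. -/
def comulAct (ρX : H →ₐ[k] Module.End k X) : H ⊗[k] X →ₗ[k] H ⊗[k] X :=
  (TensorProduct.map LinearMap.id (QuasiHopf.muAct ρX)) ∘ₗ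
    (TensorProduct.assoc k H H X).toLinearMap ∘ₗ
    (TensorProduct.map q.comul.toLinearMap LinearMap.id)

/-- `h ⊗ y ↦ h₍₁₎ ⊗ S(h₍₂₎) · y`. -/
def comulActS (ρX : H →ₐ[k] Module.End k X) : H ⊗[k] X →ₗ[k] H ⊗[k] X :=
  (TensorProduct.map LinearMap.id (QuasiHopf.muAct ρX)) ∘ₗ
    (TensorProduct.assoc k H H X).toLinearMap ∘ₗ
    (TensorProduct.map ((TensorProduct.map LinearMap.id q.S) ∘ₗ q.comul.toLinearMap)
      LinearMap.id)

/-- `θ_X(h ⊗ x) = h₍₁₎ p^R_1 ⊗ h₍₂₎ p^R_2 x`. -/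
def theta (ρX : H →ₐ[k] Module.End k X) : H ⊗[k] X →ₗ[k] H ⊗[k] X :=
  ∑ b ∈ Finset.range q.nq,
    (TensorProduct.map (LinearMap.mulRight k (q.pR1 b)) LinearMap.id) ∘ₗ
      (q.comulAct ρX) ∘ₗ (TensorProduct.map LinearMap.id (ρX (q.pR2 b)))

/-- `θ_X⁻¹(h ⊗ x) = q^R_1 h₍₁₎ ⊗ S(q^R_2 h₍₂₎) x`. -/
def thetaInv (ρX : H →ₐ[k] Module.End k X) : H ⊗[k] X →ₗ[k] H ⊗[k] X :=
  ∑ a ∈ Finset.range q.np,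
    (TensorProduct.map (LinearMap.mulLeft k (q.qR1 a)) LinearMap.id) ∘ₗ
      (q.comulActS ρX) ∘ₗ (TensorProduct.map LinearMap.id (ρX (q.S (q.qR2 a))))

end QuasiHopf

namespace QuasiHopf

variable {k H : Type} [Field k] [Ring H] [Algebra k H] (q : QuasiHopf k H)

set_option maxSynthPendingDepth 6

lemma tensor_triple_induction {A B C : Type} [AddCommGroup A] [Module k A] [AddCommGroup B]
    [Module k B] [AddCommGroup C] [Module k C] {p : A ⊗[k] (B ⊗[k] C) → Prop}
    (u : A ⊗[k] (B ⊗[k] C)) (zero : p 0) (add : ∀ u v, p u → p v → p (u + v))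
    (tmul : ∀ x y z, p (x ⊗ₜ[k] (y ⊗ₜ[k] z))) : p u := by
  induction u with
  | zero => exact zero
  | add a b ha hb => exact add a b ha hb
  | tmul x u =>
    induction u with
    | zero => simpa using zero
    | add a b ha hb => simpa [TensorProduct.tmul_add] using add _ _ ha hb
    | tmul y z => exact tmul x y z

lemma tensor_quad_induction {A B C D : Type} [AddCommGroup A] [Module k A] [AddCommGroup B]
    [Module k B] [AddCommGroup C] [Module k C] [AddCommGroup D] [Module k D]
    {p : A ⊗[k] (B ⊗[k] (C ⊗[k] D)) → Prop}
    (u : A ⊗[k] (B ⊗[k] (C ⊗[k] D))) (zero : p 0) (add : ∀ u v, p u → p v → p (u + v))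
    (tmul : ∀ x y z w, p (x ⊗ₜ[k] (y ⊗ₜ[k] (z ⊗ₜ[k] w)))) : p u := by
  refine tensor_triple_induction u zero add fun x y t => ?_
  induction t with
  | zero => simpa using zero
  | add a b ha hb => simpa [TensorProduct.tmul_add] using add _ _ ha hb
  | tmul z w => exact tmul x y z w

/-- `Δ ⊗ id`, with values in the right-nested triple tensor product. -/
def comulFst (M : Type) [Ring M] [Algebra k M] : H ⊗[k] M →ₐ[k] H ⊗[k] (H ⊗[k] M) :=
  (Algebra.TensorProduct.assoc k k k H H M).toAlgHom.comp
    (Algebra.TensorProduct.map q.comul (AlgHom.id k M))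

/-- `id ⊗ Δ`. -/
def comulSnd : H ⊗[k] H →ₐ[k] H ⊗[k] (H ⊗[k] H) :=
  Algebra.TensorProduct.map (AlgHom.id k H) q.comul

/-- `id ⊗ Δ ⊗ id`. -/
def comulMid : H ⊗[k] (H ⊗[k] H) →ₐ[k] H ⊗[k] (H ⊗[k] (H ⊗[k] H)) :=
  Algebra.TensorProduct.map (AlgHom.id k H) (q.comulFst H)

/-- `id ⊗ id ⊗ Δ`. -/
def comulLast : H ⊗[k] (H ⊗[k] H) →ₐ[k] H ⊗[k] (H ⊗[k] (H ⊗[k] H)) :=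
  Algebra.TensorProduct.map (AlgHom.id k H) q.comulSnd

/-- `u ↦ 1 ⊗ u`. -/
def oneTensor : H ⊗[k] (H ⊗[k] H) →ₐ[k] H ⊗[k] (H ⊗[k] (H ⊗[k] H)) :=
  Algebra.TensorProduct.includeRight

/-- `u ↦ u ⊗ 1`, in right-nested form. -/
def tensorOne : H ⊗[k] (H ⊗[k] H) →ₐ[k] H ⊗[k] (H ⊗[k] (H ⊗[k] H)) :=
  Algebra.TensorProduct.map (AlgHom.id k H)
    (Algebra.TensorProduct.map (AlgHom.id k H) Algebra.TensorProduct.includeLeft)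

/-- `ε ⊗ id`. -/
def counitFst (M : Type) [Ring M] [Algebra k M] : H ⊗[k] M →ₐ[k] M :=
  (Algebra.TensorProduct.lid k M).toAlgHom.comp
    (Algebra.TensorProduct.map q.counit (AlgHom.id k M))

/-- `id ⊗ ε`. -/
def counitSnd : H ⊗[k] H →ₐ[k] H :=
  (Algebra.TensorProduct.rid k k H).toAlgHom.comp
    (Algebra.TensorProduct.map (AlgHom.id k H) q.counit)

/-- `id ⊗ ε ⊗ id`. -/
def counitMid (M : Type) [Ring M] [Algebra k M] : H ⊗[k] (H ⊗[k] M) →ₐ[k] H ⊗[k] M :=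
  Algebra.TensorProduct.map (AlgHom.id k H) (q.counitFst M)

/-- `id ⊗ id ⊗ ε`. -/
def counitLast : H ⊗[k] (H ⊗[k] H) →ₐ[k] H ⊗[k] H :=
  Algebra.TensorProduct.map (AlgHom.id k H) q.counitSnd

/-- `y ⊗ z ↦ y β S(z)`. -/
def betaContr : H ⊗[k] H →ₗ[k] H :=
  LinearMap.mul' k H ∘ₗ TensorProduct.map (LinearMap.mulRight k q.beta) q.S

/-- `y ⊗ z ↦ S(y) α z`. -/
def alphaContr : H ⊗[k] H →ₗ[k] H :=
  LinearMap.mul' k H ∘ₗ TensorProduct.map (LinearMap.mulRight k q.alpha ∘ₗ q.S) LinearMap.id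

/-- `x ⊗ y ⊗ z ↦ x ⊗ y β S(z)`. -/
def betaTail : H ⊗[k] (H ⊗[k] H) →ₗ[k] H ⊗[k] H :=
  TensorProduct.map LinearMap.id q.betaContr

/-- `x ⊗ y ⊗ z ↦ x ⊗ S(y) α z`. -/
def alphaTail : H ⊗[k] (H ⊗[k] H) →ₗ[k] H ⊗[k] H :=
  TensorProduct.map LinearMap.id q.alphaContr

/-- `x ⊗ y ⊗ z ⊗ w ↦ x ⊗ y β S(z) α w`. -/
def betaAlphaTail : H ⊗[k] (H ⊗[k] (H ⊗[k] H)) →ₗ[k] H ⊗[k] H :=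
  TensorProduct.map LinearMap.id
    (LinearMap.mul' k H ∘ₗ TensorProduct.map (LinearMap.mulRight k q.beta) q.alphaContr)

/-- `x ⊗ y ⊗ z ⊗ w ↦ x ⊗ S(y) α z β S(w)`. -/
def alphaBetaTail : H ⊗[k] (H ⊗[k] (H ⊗[k] H)) →ₗ[k] H ⊗[k] H :=
  TensorProduct.map LinearMap.id
    (LinearMap.mul' k H ∘ₗ
      TensorProduct.map (LinearMap.mulRight k q.alpha ∘ₗ q.S) q.betaContr)

section Apply

variable {M : Type} [Ring M] [Algebra k M]

@[simp]
lemma comulFst_tmul (x : H) (m : M) : q.comulFst M (x ⊗ₜ[k] m) =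
    ∑ i ∈ Finset.range (q.n x), q.d1 x i ⊗ₜ[k] (q.d2 x i ⊗ₜ[k] m) := by
  simp [comulFst, q.comul_eq x, TensorProduct.sum_tmul]

@[simp]
lemma comulSnd_tmul (x y : H) : q.comulSnd (x ⊗ₜ[k] y) = x ⊗ₜ[k] q.comul y := rfl

@[simp]
lemma comulMid_tmul (x : H) (u : H ⊗[k] H) :
    q.comulMid (x ⊗ₜ[k] u) = x ⊗ₜ[k] q.comulFst H u := rfl

@[simp]
lemma comulLast_tmul (x : H) (u : H ⊗[k] H) :
    q.comulLast (x ⊗ₜ[k] u) = x ⊗ₜ[k] q.comulSnd u := rfl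

@[simp]
lemma oneTensor_apply (u : H ⊗[k] (H ⊗[k] H)) : oneTensor u = (1 : H) ⊗ₜ[k] u := rfl

@[simp]
lemma tensorOne_tmul (x y z : H) :
    tensorOne (x ⊗ₜ[k] (y ⊗ₜ[k] z)) = x ⊗ₜ[k] (y ⊗ₜ[k] (z ⊗ₜ[k] (1 : H))) := rfl

@[simp]
lemma counitFst_tmul (x : H) (m : M) : q.counitFst M (x ⊗ₜ[k] m) = q.counit x • m := rfl

@[simp]
lemma counitSnd_tmul (x y : H) : q.counitSnd (x ⊗ₜ[k] y) = q.counit y • x := by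
  simp [counitSnd]

@[simp]
lemma counitMid_tmul (x : H) (u : H ⊗[k] M) :
    q.counitMid M (x ⊗ₜ[k] u) = x ⊗ₜ[k] q.counitFst M u := rfl

@[simp]
lemma counitLast_tmul (x : H) (u : H ⊗[k] H) :
    q.counitLast (x ⊗ₜ[k] u) = x ⊗ₜ[k] q.counitSnd u := rfl

@[simp]
lemma betaContr_tmul (y z : H) : q.betaContr (y ⊗ₜ[k] z) = y * q.beta * q.S z := rfl

@[simp]
lemma alphaContr_tmul (y z : H) : q.alphaContr (y ⊗ₜ[k] z) = q.S y * q.alpha * z := rfl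

@[simp]
lemma betaTail_tmul (x : H) (u : H ⊗[k] H) :
    q.betaTail (x ⊗ₜ[k] u) = x ⊗ₜ[k] q.betaContr u := rfl

@[simp]
lemma alphaTail_tmul (x : H) (u : H ⊗[k] H) :
    q.alphaTail (x ⊗ₜ[k] u) = x ⊗ₜ[k] q.alphaContr u := rfl

@[simp]
lemma betaAlphaTail_tmul (x y : H) (u : H ⊗[k] H) :
    q.betaAlphaTail (x ⊗ₜ[k] (y ⊗ₜ[k] u)) = x ⊗ₜ[k] (y * q.beta * q.alphaContr u) := rfl

@[simp]
lemma alphaBetaTail_tmul (x y : H) (u : H ⊗[k] H) :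
    q.alphaBetaTail (x ⊗ₜ[k] (y ⊗ₜ[k] u)) = x ⊗ₜ[k] (q.S y * q.alpha * q.betaContr u) := rfl

end Apply

section Axioms

lemma Phi_mul_PhiInv : q.Phi * q.PhiInv = 1 := q.phi_phiInv

lemma PhiInv_mul_Phi : q.PhiInv * q.Phi = 1 := q.phiInv_phi

lemma map_PhiInv_eq_one {M : Type} [Ring M] [Algebra k M]
    (f : H ⊗[k] (H ⊗[k] H) →ₐ[k] M) (hf : f q.Phi = 1) : f q.PhiInv = 1 := by
  simpa [hf] using congrArg f q.Phi_mul_PhiInv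

lemma comulSnd_comul_mul_Phi (h : H) :
    q.comulSnd (q.comul h) * q.Phi = q.Phi * q.comulFst H (q.comul h) := by
  have key : q.comulSnd (q.comul h) = q.Phi * q.comulFst H (q.comul h) * q.PhiInv := by
    simpa [q.comul_eq h, Phi, PhiInv] using q.qcoassoc h
  rw [key, mul_assoc, q.PhiInv_mul_Phi, mul_one]

lemma comulFst_comul_mul_PhiInv (h : H) :
    q.comulFst H (q.comul h) * q.PhiInv = q.PhiInv * q.comulSnd (q.comul h) := by
  calc q.comulFst H (q.comul h) * q.PhiInv
      = q.PhiInv * (q.Phi * q.comulFst H (q.comul h)) * q.PhiInv := by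
        rw [← mul_assoc q.PhiInv, q.PhiInv_mul_Phi, one_mul]
    _ = _ := by
        rw [← q.comulSnd_comul_mul_Phi, mul_assoc, mul_assoc, q.Phi_mul_PhiInv, mul_one]

lemma comulLast_mul_comulFst_Phi :
    q.comulLast q.Phi * q.comulFst (H ⊗[k] H) q.Phi =
      oneTensor q.Phi * q.comulMid q.Phi * tensorOne q.Phi := by
  simpa [Phi, TensorProduct.tmul_sum] using q.pentagon

lemma counitMid_Phi : q.counitMid H q.Phi = 1 := by
  simpa [Phi, Algebra.TensorProduct.one_def] using q.counit_mid_phi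

end Axioms

section Counit

lemma counitSnd_comul (h : H) : q.counitSnd (q.comul h) = h := by
  simpa [q.comul_eq h] using q.counit_right h

lemma counitFst_comul (h : H) : q.counitFst H (q.comul h) = h := by
  simpa [q.comul_eq h] using q.counit_left h

/-- `id ⊗ id ⊗ ε ⊗ id`. -/
def counitThird : H ⊗[k] (H ⊗[k] (H ⊗[k] H)) →ₐ[k] H ⊗[k] (H ⊗[k] H) :=
  Algebra.TensorProduct.map (AlgHom.id k H) (q.counitMid H)

@[simp]
lemma counitThird_tmul (x : H) (u : H ⊗[k] (H ⊗[k] H)) :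
    q.counitThird (x ⊗ₜ[k] u) = x ⊗ₜ[k] q.counitMid H u := rfl

lemma counitThird_comulLast (u : H ⊗[k] (H ⊗[k] H)) :
    q.counitThird (q.comulLast u) = u := by
  induction u using tensor_triple_induction with
  | zero => simp
  | add a b ha hb => simp [ha, hb]
  | tmul x y z => simp [q.counitFst_comul]

lemma counitThird_comulMid (u : H ⊗[k] (H ⊗[k] H)) :
    q.counitThird (q.comulMid u) = u := by
  induction u using tensor_triple_induction with
  | zero => simp
  | add a b ha hb => simp [ha, hb]
  | tmul x y z =>
    have h := q.counit_right y
    simp only [comulMid_tmul, comulFst_tmul, counitThird_tmul, map_sum, counitMid_tmul,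
      counitFst_tmul, ← TensorProduct.smul_tmul, ← TensorProduct.sum_tmul, h]

lemma counitThird_comulFst (u : H ⊗[k] (H ⊗[k] H)) :
    q.counitThird (q.comulFst (H ⊗[k] H) u) = q.comulFst H (q.counitMid H u) := by
  induction u using tensor_triple_induction with
  | zero => simp
  | add a b ha hb => simp [ha, hb]
  | tmul x y z => simp [Finset.smul_sum]

lemma counitThird_tensorOne (u : H ⊗[k] (H ⊗[k] H)) :
    q.counitThird (tensorOne u) =
      TensorProduct.assoc k H H H (q.counitLast u ⊗ₜ[k] (1 : H)) := by
  induction u using tensor_triple_induction with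
  | zero => simp
  | add a b ha hb => simp [ha, hb, TensorProduct.add_tmul]
  | tmul x y z => simp [TensorProduct.smul_tmul]

lemma counitLast_Phi : q.counitLast q.Phi = 1 := by
  have h := congrArg q.counitThird q.comulLast_mul_comulFst_Phi
  simp only [map_mul, counitThird_comulLast, counitThird_comulMid, counitThird_comulFst,
    counitMid_Phi, map_one, mul_one, counitThird_tensorOne, oneTensor_apply, counitThird_tmul,
    ← Algebra.TensorProduct.one_def, one_mul] at h
  have hInv := congrArg (q.PhiInv * ·) h
  simp only [← mul_assoc, q.PhiInv_mul_Phi, one_mul] at hInv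
  have hCounit := congrArg (fun u => LinearMap.lTensor H q.counitSnd.toLinearMap u) hInv
  have aux : ∀ t : H ⊗[k] H, LinearMap.lTensor H q.counitSnd.toLinearMap
      (TensorProduct.assoc k H H H (t ⊗ₜ[k] (1 : H))) = t := by
    intro t
    induction t with
    | zero => simp
    | add a b ha hb => rw [TensorProduct.add_tmul, map_add, map_add, ha, hb]
    | tmul x y => simp
  simp only [aux] at hCounit
  rw [← hCounit]
  simp [Algebra.TensorProduct.one_def]

end Counit

section Tails

lemma betaContr_comul (h : H) : q.betaContr (q.comul h) = q.counit h • q.beta := by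
  simpa [q.comul_eq h] using q.antipode_beta h

lemma alphaContr_comul (h : H) : q.alphaContr (q.comul h) = q.counit h • q.alpha := by
  simpa [q.comul_eq h] using q.antipode_alpha h

lemma betaContr_mul_comul (y z h : H) :
    q.betaContr ((y ⊗ₜ[k] z) * q.comul h) = q.counit h • q.betaContr (y ⊗ₜ[k] z) := by
  have e : ∀ t : H ⊗[k] H, q.betaContr ((y ⊗ₜ[k] z) * t) = y * q.betaContr t * q.S z := by
    intro t
    induction t with
    | zero => simp
    | add a b ha hb => simp [mul_add, add_mul, ha, hb]
    | tmul a b => simp [q.S_mul, mul_assoc]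
  simp [e, betaContr_comul]

lemma alphaContr_comul_mul (y z h : H) :
    q.alphaContr (q.comul h * (y ⊗ₜ[k] z)) = q.counit h • q.alphaContr (y ⊗ₜ[k] z) := by
  have e : ∀ t : H ⊗[k] H, q.alphaContr (t * (y ⊗ₜ[k] z)) = q.S y * q.alphaContr t * z := by
    intro t
    induction t with
    | zero => simp
    | add a b ha hb => simp [mul_add, add_mul, ha, hb]
    | tmul a b => simp [q.S_mul, mul_assoc]
  simp [e, alphaContr_comul]

lemma betaTail_mul_comulSnd (u : H ⊗[k] (H ⊗[k] H)) (t : H ⊗[k] H) :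
    q.betaTail (u * q.comulSnd t) = q.betaTail u * (q.counitSnd t ⊗ₜ[k] (1 : H)) := by
  induction t with
  | zero => simp
  | add a b ha hb => simp [mul_add, TensorProduct.add_tmul, ha, hb]
  | tmul a b =>
    induction u using tensor_triple_induction with
    | zero => simp
    | add a b ha hb => rw [add_mul, map_add, ha, hb, map_add, add_mul]
    | tmul x y z => simp [betaContr_mul_comul, TensorProduct.smul_tmul']

lemma alphaTail_comulSnd_mul (u : H ⊗[k] (H ⊗[k] H)) (t : H ⊗[k] H) :
    q.alphaTail (q.comulSnd t * u) = (q.counitSnd t ⊗ₜ[k] (1 : H)) * q.alphaTail u := by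
  induction t with
  | zero => simp
  | add a b ha hb => simp [add_mul, TensorProduct.add_tmul, ha, hb]
  | tmul a b =>
    induction u using tensor_triple_induction with
    | zero => simp
    | add a b ha hb => rw [mul_add, map_add, ha, hb, map_add, mul_add]
    | tmul x y z => simp [alphaContr_comul_mul, TensorProduct.smul_tmul']

lemma betaAlphaTail_comulLast_mul (u : H ⊗[k] (H ⊗[k] H))
    (v : H ⊗[k] (H ⊗[k] (H ⊗[k] H))) :
    q.betaAlphaTail (q.comulLast u * v) = q.counitLast u * q.betaAlphaTail v := by
  induction u using tensor_triple_induction with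
  | zero => simp
  | add a b ha hb => simp [add_mul, ha, hb]
  | tmul a b c =>
    induction v using tensor_quad_induction with
    | zero => simp
    | add s t hs ht => rw [mul_add, map_add, hs, ht, map_add, mul_add]
    | tmul x y z w => simp [alphaContr_comul_mul, mul_assoc]

lemma betaAlphaTail_mul_comulMid (u : H ⊗[k] (H ⊗[k] H))
    (v : H ⊗[k] (H ⊗[k] (H ⊗[k] H))) :
    q.betaAlphaTail (v * q.comulMid u) = q.betaAlphaTail v * q.counitMid H u := by
  induction u using tensor_triple_induction with
  | zero => simp
  | add a b ha hb => simp [mul_add, ha, hb]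
  | tmul a b c =>
    induction v using tensor_quad_induction with
    | zero => simp
    | add s t hs ht => rw [add_mul, map_add, hs, ht, map_add, add_mul]
    | tmul x y z w =>
      have h : ∑ i ∈ Finset.range (q.n b),
          y * q.d1 b i * q.beta * (q.S (z * q.d2 b i) * q.alpha * (w * c)) =
          y * (∑ i ∈ Finset.range (q.n b), q.d1 b i * q.beta * q.S (q.d2 b i)) *
            (q.S z * q.alpha * (w * c)) := by
        simp only [Finset.mul_sum, Finset.sum_mul, q.S_mul, mul_assoc]
      rw [q.antipode_beta] at h
      simpa [Finset.mul_sum, TensorProduct.tmul_sum, mul_assoc] using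
        congrArg (fun t => (x * a) ⊗ₜ[k] t) h

lemma alphaBetaTail_mul_comulLast {u : H ⊗[k] (H ⊗[k] H)} (hu : q.counitLast u = 1)
    (v : H ⊗[k] (H ⊗[k] (H ⊗[k] H))) :
    q.alphaBetaTail (v * q.comulLast u) = q.alphaBetaTail v := by
  induction v using tensor_quad_induction with
  | zero => simp
  | add s t hs ht => rw [add_mul, map_add, hs, ht, map_add]
  | tmul x y z w =>
    have h : q.alphaBetaTail ((x ⊗ₜ[k] (y ⊗ₜ[k] (z ⊗ₜ[k] w))) * q.comulLast u) =
        TensorProduct.map (LinearMap.mulLeft k x)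
          (LinearMap.mulRight k (q.S y * q.alpha * (z * q.beta * q.S w)) ∘ₗ q.S)
          (q.counitLast u) := by
      clear hu
      induction u using tensor_triple_induction with
      | zero => simp
      | add a b ha hb => simp [mul_add, ha, hb]
      | tmul a b c => simp [betaContr_mul_comul, q.S_mul, mul_assoc]
    simp [h, hu, Algebra.TensorProduct.one_def, q.S_one, mul_assoc]

lemma alphaBetaTail_comulMid_mul {u : H ⊗[k] (H ⊗[k] H)} (hu : q.counitMid H u = 1)
    (v : H ⊗[k] (H ⊗[k] (H ⊗[k] H))) :
    q.alphaBetaTail (q.comulMid u * v) = q.alphaBetaTail v := by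
  induction v using tensor_quad_induction with
  | zero => simp
  | add s t hs ht => rw [mul_add, map_add, hs, ht, map_add]
  | tmul x y z w =>
    have h : q.alphaBetaTail (q.comulMid u * (x ⊗ₜ[k] (y ⊗ₜ[k] (z ⊗ₜ[k] w)))) =
        TensorProduct.map (LinearMap.mulRight k x)
          (LinearMap.mulLeft k (q.S y * q.alpha * (z * q.beta * q.S w)) ∘ₗ q.S)
          (q.counitMid H u) := by
      clear hu
      induction u using tensor_triple_induction with
      | zero => simp
      | add a b ha hb => simp [add_mul, ha, hb]
      | tmul a b c =>
        have h : ∑ i ∈ Finset.range (q.n b),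
            q.S (q.d1 b i * y) * q.alpha * (q.d2 b i * z * q.beta * q.S (c * w)) =
            q.S y * (∑ i ∈ Finset.range (q.n b), q.S (q.d1 b i) * q.alpha * q.d2 b i) *
              (z * q.beta * q.S (c * w)) := by
          simp only [Finset.mul_sum, Finset.sum_mul, q.S_mul, mul_assoc]
        rw [q.antipode_alpha] at h
        simpa [Finset.sum_mul, TensorProduct.tmul_sum, q.S_mul, mul_assoc] using
          congrArg (fun t => (a * x) ⊗ₜ[k] t) h
    simp [h, hu, Algebra.TensorProduct.one_def, q.S_one, mul_assoc]

lemma betaAlphaTail_oneTensor_Phi : q.betaAlphaTail (oneTensor q.Phi) = 1 := by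
  simpa [Phi, TensorProduct.tmul_sum, mul_assoc, Algebra.TensorProduct.one_def] using
    congrArg (fun t => (1 : H) ⊗ₜ[k] t) q.nondeg_1

lemma alphaBetaTail_oneTensor_PhiInv : q.alphaBetaTail (oneTensor q.PhiInv) = 1 := by
  simpa [PhiInv, TensorProduct.tmul_sum, mul_assoc, Algebra.TensorProduct.one_def] using
    congrArg (fun t => (1 : H) ⊗ₜ[k] t) q.nondeg_2

lemma betaAlphaTail_comulFst_Phi_mul :
    q.betaAlphaTail (q.comulFst (H ⊗[k] H) q.Phi * tensorOne q.PhiInv) = 1 := by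
  have e : q.comulFst (H ⊗[k] H) q.Phi * tensorOne q.PhiInv =
      q.comulLast q.PhiInv * (oneTensor q.Phi * q.comulMid q.Phi) := by
    calc _ = q.comulLast (q.PhiInv * q.Phi) * q.comulFst (H ⊗[k] H) q.Phi *
          tensorOne q.PhiInv := by rw [q.PhiInv_mul_Phi, map_one, one_mul]
      _ = q.comulLast q.PhiInv * (oneTensor q.Phi * q.comulMid q.Phi) *
          tensorOne (q.Phi * q.PhiInv) := by
        rw [map_mul, mul_assoc (q.comulLast _), comulLast_mul_comulFst_Phi, map_mul]
        simp only [mul_assoc]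
      _ = _ := by rw [q.Phi_mul_PhiInv, map_one, mul_one]
  rw [e, betaAlphaTail_comulLast_mul, betaAlphaTail_mul_comulMid, counitMid_Phi,
    betaAlphaTail_oneTensor_Phi, q.map_PhiInv_eq_one _ q.counitLast_Phi, mul_one, mul_one]

lemma alphaBetaTail_mul_comulFst_PhiInv :
    q.alphaBetaTail (tensorOne q.Phi * q.comulFst (H ⊗[k] H) q.PhiInv) = 1 := by
  have e : tensorOne q.Phi * q.comulFst (H ⊗[k] H) q.PhiInv =
      q.comulMid q.PhiInv * (oneTensor q.PhiInv * q.comulLast q.Phi) := by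
    calc _ = q.comulMid q.PhiInv * (oneTensor (q.PhiInv * q.Phi) * q.comulMid q.Phi) *
          tensorOne q.Phi * q.comulFst (H ⊗[k] H) q.PhiInv := by
            rw [q.PhiInv_mul_Phi, map_one, one_mul, ← map_mul, q.PhiInv_mul_Phi, map_one,
              one_mul]
      _ = q.comulMid q.PhiInv * (oneTensor q.PhiInv *
          (oneTensor q.Phi * q.comulMid q.Phi * tensorOne q.Phi)) *
          q.comulFst (H ⊗[k] H) q.PhiInv := by
        rw [map_mul]
        simp only [mul_assoc]
      _ = q.comulMid q.PhiInv * (oneTensor q.PhiInv * q.comulLast q.Phi) *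
          q.comulFst (H ⊗[k] H) (q.Phi * q.PhiInv) := by
        rw [← comulLast_mul_comulFst_Phi, map_mul]
        simp only [mul_assoc]
      _ = _ := by rw [q.Phi_mul_PhiInv, map_one, mul_one]
  rw [e, q.alphaBetaTail_comulMid_mul (q.map_PhiInv_eq_one _ q.counitMid_Phi),
    q.alphaBetaTail_mul_comulLast q.counitLast_Phi, alphaBetaTail_oneTensor_PhiInv]

lemma pRE_eq : q.pRE = q.betaTail q.PhiInv := by
  simp [pRE, PhiInv, pR1, pR2]

/-- `x ⊗ y ⊗ z ↦ x ⊗ S̄(α z) y`. -/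
def sinvTail : H ⊗[k] (H ⊗[k] H) →ₗ[k] H ⊗[k] H :=
  TensorProduct.map LinearMap.id
    (LinearMap.mul' k H ∘ₗ TensorProduct.map (q.Sinv ∘ₗ LinearMap.mulLeft k q.alpha)
      LinearMap.id ∘ₗ (TensorProduct.comm k H H).toLinearMap)

@[simp]
lemma sinvTail_tmul (x y z : H) :
    q.sinvTail (x ⊗ₜ[k] (y ⊗ₜ[k] z)) = x ⊗ₜ[k] (q.Sinv (q.alpha * z) * y) := rfl

lemma qRE_eq : q.qRE = q.sinvTail q.Phi := by
  simp [qRE, Phi, qR1, qR2]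

lemma alphaTail_mul_comulFst_betaTail (u v : H ⊗[k] (H ⊗[k] H)) :
    q.alphaTail (u * q.comulFst H (q.betaTail v)) =
      q.alphaBetaTail (tensorOne u * q.comulFst (H ⊗[k] H) v) := by
  induction v using tensor_triple_induction with
  | zero => simp
  | add a b ha hb => simp [mul_add, ha, hb]
  | tmul a b c =>
    induction u using tensor_triple_induction with
    | zero => simp
    | add s t hs ht => rw [add_mul, map_add, hs, ht, map_add, add_mul, map_add]
    | tmul x y z => simp [Finset.mul_sum, mul_assoc]

lemma betaTail_comulFst_sinvTail_mul (u v : H ⊗[k] (H ⊗[k] H)) :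
    q.betaTail (q.comulFst H (q.sinvTail u) * v) =
      q.betaAlphaTail (q.comulFst (H ⊗[k] H) u * tensorOne v) := by
  induction u using tensor_triple_induction with
  | zero => simp
  | add a b ha hb => simp [add_mul, ha, hb]
  | tmul a b c =>
    induction v using tensor_triple_induction with
    | zero => simp
    | add s t hs ht => rw [mul_add, map_add, hs, ht, map_add, mul_add, map_add]
    | tmul x y z => simp [Finset.sum_mul, mul_assoc, q.S_mul, q.S_Sinv]

lemma alphaTail_Phi_mul_comulFst (h : H) :
    q.alphaTail (q.Phi * q.comulFst H (q.comul h * q.pRE)) = h ⊗ₜ[k] 1 := by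
  rw [map_mul (q.comulFst H), ← mul_assoc, ← comulSnd_comul_mul_Phi, mul_assoc,
    alphaTail_comulSnd_mul, pRE_eq, alphaTail_mul_comulFst_betaTail, alphaBetaTail_mul_comulFst_PhiInv,
    counitSnd_comul, mul_one]

lemma betaTail_comulFst_mul_PhiInv (h : H) :
    q.betaTail (q.comulFst H (q.qRE * q.comul h) * q.PhiInv) = h ⊗ₜ[k] 1 := by
  rw [map_mul (q.comulFst H), mul_assoc, comulFst_comul_mul_PhiInv, ← mul_assoc,
    betaTail_mul_comulSnd, qRE_eq, betaTail_comulFst_sinvTail_mul, betaAlphaTail_comulFst_Phi_mul,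
    counitSnd_comul, one_mul]

end Tails

section Theta

variable {X : Type} [AddCommGroup X] [Module k X] (ρX : H →ₐ[k] Module.End k X)

/-- `a ⊗ b ↦ a ⊗ b x`. -/
def actOn (x : X) : H ⊗[k] H →ₗ[k] H ⊗[k] X :=
  TensorProduct.map LinearMap.id (LinearMap.applyₗ x ∘ₗ ρX.toLinearMap)

@[simp]
lemma actOn_tmul (x : X) (a b : H) : actOn ρX x (a ⊗ₜ[k] b) = a ⊗ₜ[k] ρX b x := rfl

lemma comulAct_tmul (h : H) (x : X) :
    q.comulAct ρX (h ⊗ₜ[k] x) = actOn ρX x (q.comul h) := by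
  simp [comulAct, muAct, q.comul_eq h, TensorProduct.sum_tmul]

lemma theta_tmul (h : H) (x : X) :
    q.theta ρX (h ⊗ₜ[k] x) = actOn ρX x (q.comul h * q.pRE) := by
  rw [pRE, Finset.mul_sum]
  simp [theta, comulAct_tmul, q.comul_eq h, Finset.sum_mul]

lemma thetaInv_tmul (h : H) (x : X) :
    q.thetaInv ρX (h ⊗ₜ[k] x) =
      actOn ρX x (TensorProduct.map LinearMap.id q.S (q.qRE * q.comul h)) := by
  simp [thetaInv, comulActS, muAct, q.comul_eq h, qRE, Finset.sum_mul_sum,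
    TensorProduct.sum_tmul, q.S_mul]

lemma theta_actOn (t : H ⊗[k] H) (x : X) :
    q.theta ρX (actOn ρX x (TensorProduct.map LinearMap.id q.S t)) =
      actOn ρX x (q.betaTail (q.comulFst H t * q.PhiInv)) := by
  induction t with
  | zero => simp
  | add a b ha hb => simp [add_mul, ha, hb]
  | tmul a b =>
    simp [theta_tmul, q.comul_eq a, pRE, pR1, pR2, PhiInv, Finset.sum_mul_sum, q.S_mul]

lemma thetaInv_actOn (t : H ⊗[k] H) (x : X) :
    q.thetaInv ρX (actOn ρX x t) =
      actOn ρX x (q.alphaTail (q.Phi * q.comulFst H t)) := by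
  induction t with
  | zero => simp
  | add a b ha hb => simp [mul_add, ha, hb]
  | tmul a b =>
    simp [thetaInv_tmul, q.comul_eq a, qRE, qR1, qR2, Phi, Finset.sum_mul_sum, q.S_mul,
      q.S_Sinv]

lemma thetaInv_theta (m : H ⊗[k] X) : q.thetaInv ρX (q.theta ρX m) = m := by
  induction m with
  | zero => simp
  | add a b ha hb => simp [ha, hb]
  | tmul h x =>
    rw [theta_tmul, thetaInv_actOn, alphaTail_Phi_mul_comulFst]
    simp

lemma theta_thetaInv (m : H ⊗[k] X) : q.theta ρX (q.thetaInv ρX m) = m := by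
  induction m with
  | zero => simp
  | add a b ha hb => simp [ha, hb]
  | tmul h x =>
    rw [thetaInv_tmul, theta_actOn, betaTail_comulFst_mul_PhiInv]
    simp

lemma tensAct_counit_tmul (h g : H) (x : X) :
    q.tensAct (fun h => Algebra.lmul k H h)
      (fun h => ((Algebra.ofId k (Module.End k X)).comp q.counit) h) h (g ⊗ₜ[k] x) =
      (h * g) ⊗ₜ[k] x := by
  conv_rhs => rw [← q.counit_right h]
  simp [tensAct, Algebra.ofId_apply, Finset.sum_mul, TensorProduct.sum_tmul,
    TensorProduct.smul_tmul']

lemma tensAct_actOn (h : H) (t : H ⊗[k] H) (x : X) :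
    q.tensAct (fun h => Algebra.lmul k H h) (fun h => ρX h) h (actOn ρX x t) =
      actOn ρX x (q.comul h * t) := by
  induction t with
  | zero => simp
  | add a b ha hb => rw [map_add, map_add, ha, hb, mul_add, map_add]
  | tmul a b => simp [tensAct, q.comul_eq h, Finset.sum_mul]

lemma isHLin_theta :
    IsHLin
      (q.tensAct (fun h => Algebra.lmul k H h)
        (fun h => ((Algebra.ofId k (Module.End k X)).comp q.counit) h))
      (q.tensAct (fun h => Algebra.lmul k H h) (fun h => ρX h))
      (q.theta ρX) := by
  intro h m
  induction m with
  | zero => simp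
  | add a b ha hb => rw [map_add, map_add, ha, hb, map_add, map_add]
  | tmul g x =>
    rw [tensAct_counit_tmul, theta_tmul, theta_tmul, tensAct_actOn, map_mul q.comul, mul_assoc]

end Theta

end QuasiHopf

/-- The map `θ_X : H ⊗ X₀ → H ⊗ X`, `h ⊗ x ↦ h₍₁₎ p^R_1 ⊗ h₍₂₎ p^R_2 x`,
is an `H`-linear bijection (where `X₀` carries the trivial action through `ε` and `H`
acts on itself by left multiplication, tensor modules via `Δ`), with inverse
`h ⊗ x ↦ q^R_1 h₍₁₎ ⊗ S(q^R_2 h₍₂₎) x`. -/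
theorem statement16 (k H : Type) [Field k] [Ring H] [Algebra k H] (q : QuasiHopf k H)
    (X : Type) [AddCommGroup X] [Module k X] (ρX : H →ₐ[k] Module.End k X) :
    IsHLin
      (q.tensAct (fun h => Algebra.lmul k H h)
        (fun h => ((Algebra.ofId k (Module.End k X)).comp q.counit) h))
      (q.tensAct (fun h => Algebra.lmul k H h) (fun h => ρX h))
      (q.theta ρX) ∧
    Function.Bijective (q.theta ρX) ∧
    (∀ m : H ⊗[k] X, q.thetaInv ρX (q.theta ρX m) = m) ∧
    (∀ m : H ⊗[k] X, q.theta ρX (q.thetaInv ρX m) = m) := by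
  exact ⟨q.isHLin_theta ρX,
    Function.bijective_iff_has_inverse.mpr
      ⟨q.thetaInv ρX, q.thetaInv_theta ρX, q.theta_thetaInv ρX⟩,
    q.thetaInv_theta ρX, q.theta_thetaInv ρX⟩
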